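/- Let T : L∞[0,1] ≃ ℓ∞ be a continuous linear equivalence with ‖Tg‖ ≥ ‖g‖ for every g, let φ_n = T⁻¹(e_n), and let r = sup{‖∑_{i∈I} σ(i)·φ_i‖ : I ⊆ ℕ finite, σ : I → ({−1,1} : Set ℝ)}; assume r ≥ 1/6. Let ε > 0, let I ⊆ ℕ be finite, σ : I → {−1,1}, φ = ∑_{i∈I} σ(i)·φ_i with ‖φ‖ > r − ε, and let B ⊆ [0,1] be measurable of positive Lebesgue measure with φ(x) > r − ε for almost every x ∈ B. For a measurable A ⊆ B of positive measure set a = ‖T(χ_A)‖, θ = (1−r)/(2ar+1), let Φ_A ∈ L∞[0,1] be the element represented by the a.e.-convergent series x ↦ ∑_{n ∉ I} (Tχ_A)(n)·φ_n(x), and let f_A = (1/(1+ε))·(φ + (1−r+6ε)·χ_A − θ·Φ_A). Then: (a) for every such A, ‖f_A‖ > 1; (b) there exists such an A ⊆ B of positive measure with |(T f_A)(i)| < 1 for every i ∈ I. -/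

import Mathlib

open MeasureTheory ENNReal

/-- Lebesgue measure restricted to the unit interval `[0,1]`. -/
noncomputable def μ01 : Measure ℝ := volume.restrict (Set.Icc (0 : ℝ) 1)

instance μ01_finite : IsFiniteMeasure μ01 := by
  unfold μ01; infer_instance

instance μ01_noAtoms : NullSingletonClass μ01 := by
  unfold μ01; infer_instance

lemma ae_abs_le_norm (f : Lp ℝ ∞ μ01) : ∀ᵐ x ∂μ01, |(f : ℝ → ℝ) x| ≤ ‖f‖ := by
  filter_upwards [ae_le_eLpNormEssSup (f := (f : ℝ → ℝ)) (μ := μ01)] with x hx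
  rw [Lp.norm_def, eLpNorm_exponent_top, ← Real.norm_eq_abs, ← toReal_enorm]
  apply ENNReal.toReal_mono _ hx
  have := Lp.eLpNorm_ne_top f
  rwa [eLpNorm_exponent_top] at this

lemma norm_le_of_ae {f : Lp ℝ ∞ μ01} {C : ℝ} (hC : 0 ≤ C)
    (h : ∀ᵐ x ∂μ01, |(f : ℝ → ℝ) x| ≤ C) : ‖f‖ ≤ C := by
  have := Lp.norm_le_of_ae_bound (p := ∞) (f := f) hC h
  simpa using this

lemma coeFn_sum_smul {ι : Type*} (F : Finset ι) (c : ι → ℝ) (g : ι → Lp ℝ ∞ μ01) :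
    ∀ᵐ x ∂μ01, ((∑ i ∈ F, c i • g i : Lp ℝ ∞ μ01) : ℝ → ℝ) x
      = ∑ i ∈ F, c i * (g i : ℝ → ℝ) x := by
  classical
  induction F using Finset.induction_on with
  | empty =>
    filter_upwards [Lp.coeFn_zero ℝ ∞ μ01] with x hx
    simpa using hx
  | insert a s ha ih =>
    rw [Finset.sum_insert ha]
    filter_upwards [ih, Lp.coeFn_add (c a • g a) (∑ i ∈ s, c i • g i),
      Lp.coeFn_smul (c a) (g a)] with x h1 h2 h3
    rw [h2, Finset.sum_insert ha, Pi.add_apply, h1, h3]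
    simp

lemma split_set (B : Set ℝ) (hB : MeasurableSet B) (hp : 0 < μ01 B) :
    ∃ C : Set ℝ, MeasurableSet C ∧ C ⊆ B ∧ 0 < μ01 C ∧ 0 < μ01 (B \ C) := by
  obtain ⟨x, hx, hx'⟩ := exists_mem_forall_mem_nhdsWithin_pos_measure hp.ne'
  have h2 : μ01 (B \ {x}) ≠ 0 := by
    rw [measure_sdiff_null (measure_singleton x)]; exact hp.ne'
  obtain ⟨y, hy, hy'⟩ := exists_mem_forall_mem_nhdsWithin_pos_measure h2
  have hxy : x ≠ y := fun h => hy.2 (by simp [h])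
  obtain ⟨U, V, hU, hV, hxU, hyV, hUV⟩ := t2_separation hxy
  refine ⟨B ∩ U, hB.inter hU.measurableSet, Set.inter_subset_left, ?_, ?_⟩
  · exact hx' _ (inter_mem_nhdsWithin _ (hU.mem_nhds hxU))
  · refine (hy' _ (inter_mem_nhdsWithin _ (hV.mem_nhds hyV))).trans_le (measure_mono ?_)
    rintro z ⟨⟨hz, -⟩, hzV⟩
    exact ⟨hz, fun h => Set.disjoint_left.1 hUV h.2 hzV⟩

lemma exists_disjoint_seq (B : Set ℝ) (hB : MeasurableSet B) (hp : 0 < μ01 B) :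
    ∃ A : ℕ → Set ℝ, (∀ k, MeasurableSet (A k) ∧ A k ⊆ B ∧ 0 < μ01 (A k)) ∧
      Pairwise (fun i j => Disjoint (A i) (A j)) := by
  choose! f hf using split_set
  let D : ℕ → Set ℝ := fun n => f^[n] B
  have hs : ∀ n, D (n+1) = f (D n) := fun n => Function.iterate_succ_apply' f n B
  have hD : ∀ n, MeasurableSet (D n) ∧ 0 < μ01 (D n) := by
    intro n
    induction n with
    | zero => exact ⟨hB, hp⟩
    | succ n ih =>
      rw [hs]
      exact ⟨(hf _ ih.1 ih.2).1, (hf _ ih.1 ih.2).2.2.1⟩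
  have hanti : Antitone D := antitone_nat_of_succ_le fun n => by
    rw [hs]; exact (hf _ (hD n).1 (hD n).2).2.1
  refine ⟨fun n => D n \ D (n+1), fun n => ⟨(hD n).1.diff (hD (n+1)).1, ?_, ?_⟩, ?_⟩
  · exact Set.sdiff_subset.trans (hanti (Nat.zero_le n))
  · have := (hf _ (hD n).1 (hD n).2).2.2.2
    rwa [← hs] at this
  · have key : ∀ i j, i < j → Disjoint (D i \ D (i+1)) (D j \ D (j+1)) := by
      intro i j hij
      rw [Set.disjoint_left]
      intro z hz hz'
      exact hz.2 (hanti (Nat.succ_le_of_lt hij) hz'.1)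
    intro i j hij
    rcases lt_or_gt_of_ne hij with h | h
    · exact key i j h
    · exact (key j i h).symm

lemma functional_tendsto (A : ℕ → Set ℝ) 
    (hd : Pairwise (fun i j => Disjoint (A i) (A j)))
    (χ : ℕ → Lp ℝ ∞ μ01)
    (hχ : ∀ k, (χ k : ℝ → ℝ) =ᵐ[μ01] (A k).indicator (fun _ => (1 : ℝ)))
    (L : Lp ℝ ∞ μ01 →L[ℝ] ℝ) :
    Filter.Tendsto (fun k => |L (χ k)|) Filter.atTop (nhds 0) := by
  apply Summable.tendsto_atTop_zero
  refine summable_of_sum_le (c := ‖L‖) (fun _ => abs_nonneg _) fun F => ?_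
  let s : ℕ → ℝ := fun k => if 0 ≤ L (χ k) then 1 else -1
  have hs : ∀ k, |s k| = 1 := fun k => by simp only [s]; split_ifs <;> simp
  have h1 : ∑ k ∈ F, |L (χ k)| = L (∑ k ∈ F, s k • χ k) := by
    rw [map_sum]
    refine Finset.sum_congr rfl fun k _ => ?_
    simp only [s, map_smul, smul_eq_mul]
    split_ifs with h
    · rw [abs_of_nonneg h, one_mul]
    · rw [abs_of_neg (not_le.1 h)]; ring
  have h2 : ‖∑ k ∈ F, s k • χ k‖ ≤ 1 := by
    apply norm_le_of_ae zero_le_one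
    filter_upwards [coeFn_sum_smul F s χ, ae_all_iff.2 hχ] with x hx hx'
    rw [hx]
    simp only [hx']
    by_cases h : ∃ j ∈ F, x ∈ A j
    · obtain ⟨j, hj, hxj⟩ := h
      rw [Finset.sum_eq_single_of_mem j hj]
      · simp [hxj, hs]
      · intro b _ hb
        have : x ∉ A b := fun hxb => Set.disjoint_left.1 (hd hb) hxb hxj
        simp [this]
    · push Not at h
      rw [Finset.sum_eq_zero]
      · simp
      · intro b hb
        simp [h b hb]
  rw [h1]
  calc L (∑ k ∈ F, s k • χ k) ≤ ‖L (∑ k ∈ F, s k • χ k)‖ := le_abs_self _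
    _ ≤ ‖L‖ * ‖∑ k ∈ F, s k • χ k‖ := L.le_opNorm _
    _ ≤ ‖L‖ * 1 := by gcongr
    _ = ‖L‖ := mul_one _

/-- The a.e. bound on absolute sums. -/
lemma ae_sum_abs_le (φ : ℕ → Lp ℝ ∞ μ01) (r : ℝ)
    (h : ∀ (F : Finset ℕ) (σ : ℕ → ℝ), (∀ i ∈ F, σ i = 1 ∨ σ i = -1) →
      ‖∑ i ∈ F, σ i • φ i‖ ≤ r) :
    ∀ᵐ x ∂μ01, ∀ F : Finset ℕ, ∑ i ∈ F, |(φ i : ℝ → ℝ) x| ≤ r := by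
  classical
  have key : ∀ᵐ x ∂μ01, ∀ F P : Finset ℕ,
      ∑ i ∈ F, (if i ∈ P then (1:ℝ) else -1) * (φ i : ℝ → ℝ) x ≤ r := by
    rw [ae_all_iff]; intro F
    rw [ae_all_iff]; intro P
    filter_upwards [coeFn_sum_smul F (fun i => if i ∈ P then (1:ℝ) else -1) φ,
      ae_abs_le_norm (∑ i ∈ F, (if i ∈ P then (1:ℝ) else -1) • φ i)] with x h1 h2
    rw [← h1]
    refine (le_abs_self _).trans (h2.trans (h _ _ ?_))
    intro i _
    split_ifs <;> simp
  filter_upwards [key] with x hx F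
  refine le_trans (le_of_eq ?_) (hx F (F.filter fun i => 0 ≤ (φ i : ℝ → ℝ) x))
  refine Finset.sum_congr rfl fun i hi => ?_
  by_cases h0 : 0 ≤ (φ i : ℝ → ℝ) x
  · simp [hi, h0, abs_of_nonneg h0]
  · simp [h0, abs_of_neg (not_le.1 h0)]

lemma abs_term_sum_le (I : Finset ℕ) (y : lp (fun _ : ℕ => ℝ) ∞) (f : ℕ → ℝ) (C : ℝ)
    (hf : ∀ F : Finset ℕ, Disjoint F I → ∑ i ∈ F, |f i| ≤ C)
    (G : Finset {n : ℕ // n ∉ I}) :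
    ∑ n ∈ G, |y (n : ℕ) * f n| ≤ ‖y‖ * C := by
  calc ∑ n ∈ G, |y (n : ℕ) * f n| ≤ ∑ n ∈ G, ‖y‖ * |f n| := by
        refine Finset.sum_le_sum fun n _ => ?_
        rw [abs_mul]
        gcongr
        exact lp.norm_apply_le_norm (by simp) y n
    _ = ‖y‖ * ∑ i ∈ G.map (Function.Embedding.subtype _), |f i| := by
        rw [← Finset.mul_sum, Finset.sum_map]; rfl
    _ ≤ ‖y‖ * C := by
        gcongr
        apply hf
        rw [Finset.disjoint_left]
        intro a ha
        simp only [Finset.mem_map, Function.Embedding.subtype_apply] at ha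
        obtain ⟨b, _, rfl⟩ := ha
        exact b.2

lemma abs_hasSum_le (I : Finset ℕ) (y : lp (fun _ : ℕ => ℝ) ∞) (f : ℕ → ℝ) (C : ℝ)
    (hf : ∀ F : Finset ℕ, Disjoint F I → ∑ i ∈ F, |f i| ≤ C) (s : ℝ)
    (h : HasSum (fun n : {n : ℕ // n ∉ I} => y (n : ℕ) * f n) s) : |s| ≤ ‖y‖ * C := by
  have h1 : Filter.Tendsto
      (fun G : Finset {n : ℕ // n ∉ I} => |∑ n ∈ G, y (n : ℕ) * f n|) Filter.atTop (nhds |s|) :=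
    Filter.Tendsto.abs h
  refine le_of_tendsto' h1 fun G => ?_
  exact (Finset.abs_sum_le_sum_abs _ _).trans (abs_term_sum_le I y f C hf G)

lemma summable_term (I : Finset ℕ) (y : lp (fun _ : ℕ => ℝ) ∞) (f : ℕ → ℝ) (C : ℝ)
    (hf : ∀ F : Finset ℕ, ∑ i ∈ F, |f i| ≤ C) :
    Summable (fun n : {n : ℕ // n ∉ I} => y (n : ℕ) * f n) := by
  apply Summable.of_abs
  exact summable_of_sum_le (fun _ => abs_nonneg _) (abs_term_sum_le I y f C fun F _ => hf F)

/-- The synthesis operator. -/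
lemma exists_synthesis (φ : ℕ → Lp ℝ ∞ μ01) (r : ℝ) (hr0 : 0 ≤ r)
    (h : ∀ᵐ x ∂μ01, ∀ F : Finset ℕ, ∑ i ∈ F, |(φ i : ℝ → ℝ) x| ≤ r) (I : Finset ℕ) :
    ∃ S : lp (fun _ : ℕ => ℝ) ∞ →L[ℝ] Lp ℝ ∞ μ01, ∀ y, ∀ᵐ x ∂μ01, HasSum
          (fun n : {n : ℕ // n ∉ I} => y (n : ℕ) * (φ (n : ℕ) : ℝ → ℝ) x)
          ((S y : ℝ → ℝ) x) := by
  have hex : ∀ y : lp (fun _ : ℕ => ℝ) ∞, ∃ g : Lp ℝ ∞ μ01, ∀ᵐ x ∂μ01, HasSum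
          (fun n : {n : ℕ // n ∉ I} => y (n : ℕ) * (φ (n : ℕ) : ℝ → ℝ) x)
          ((g : ℝ → ℝ) x) := by
    intro y
    let g : ℝ → ℝ := fun x => ∑' n : {n : ℕ // n ∉ I}, y (n : ℕ) * (φ (n : ℕ) : ℝ → ℝ) x
    have hg : ∀ᵐ x ∂μ01, HasSum
          (fun n : {n : ℕ // n ∉ I} => y (n : ℕ) * (φ (n : ℕ) : ℝ → ℝ) x) (g x) := by
      filter_upwards [h] with x hx
      exact (summable_term I y (fun n => (φ n : ℝ → ℝ) x) r hx).hasSum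
    have hm : AEStronglyMeasurable g μ01 := by
      refine aestronglyMeasurable_of_tendsto_ae Filter.atTop
        (f := fun (G : Finset {n : ℕ // n ∉ I}) x =>
          ∑ n ∈ G, y (n : ℕ) * (φ (n : ℕ) : ℝ → ℝ) x) (fun G => ?_) hg
      refine Finset.aestronglyMeasurable_fun_sum _ fun n _ => ?_
      exact (Lp.aestronglyMeasurable (φ n)).const_mul _
    have hmem : MemLp g ∞ μ01 := by
      refine memLp_top_of_bound hm (‖y‖ * r) ?_
      filter_upwards [h, hg] with x hx hx'
      exact abs_hasSum_le I y (fun n => (φ n : ℝ → ℝ) x) r (fun F _ => hx F) _ hx'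
    refine ⟨hmem.toLp g, ?_⟩
    filter_upwards [hg, hmem.coeFn_toLp] with x h1 h2
    rw [h2]; exact h1
  choose S hS using hex
  let SL : lp (fun _ : ℕ => ℝ) ∞ →ₗ[ℝ] Lp ℝ ∞ μ01 :=
    { toFun := S
      map_add' := by
        intro y z
        apply Lp.ext
        filter_upwards [hS y, hS z, hS (y + z), Lp.coeFn_add (S y) (S z)] with x h1 h2 h3 h4
        rw [h4, Pi.add_apply]
        refine h3.unique ?_
        have h5 := h1.add h2
        simp only [← add_mul] at h5
        exact h5
      map_smul' := by
        intro c y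
        apply Lp.ext
        filter_upwards [hS y, hS (c • y), Lp.coeFn_smul c (S y)] with x h1 h3 h4
        rw [RingHom.id_apply, h4, Pi.smul_apply, smul_eq_mul]
        refine h3.unique ?_
        have h5 := h1.mul_left c
        simp only [← mul_assoc] at h5
        exact h5 }
  refine ⟨SL.mkContinuous r ?_, hS⟩
  intro y
  rw [mul_comm]
  refine norm_le_of_ae (by positivity) ?_
  filter_upwards [h, hS y] with x hx hx'
  exact abs_hasSum_le I y (fun n => (φ n : ℝ → ℝ) x) r (fun F _ => hx F) _ hx'

lemma norm_signed_le_one (T : Lp ℝ ∞ μ01 ≃L[ℝ] lp (fun _ : ℕ => ℝ) ∞)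
    (hT : ∀ g : Lp ℝ ∞ μ01, ‖g‖ ≤ ‖T g‖)
    (φ : ℕ → Lp ℝ ∞ μ01) (hφ : ∀ n, φ n = T.symm (lp.single ∞ n 1))
    (F : Finset ℕ) (σ : ℕ → ℝ) (hσ : ∀ i ∈ F, σ i = 1 ∨ σ i = -1) :
    (∀ i, T (∑ i ∈ F, σ i • φ i) i = if i ∈ F then σ i else 0) ∧
    ‖∑ i ∈ F, σ i • φ i‖ ≤ 1 := by
  have h1 : ∀ i, T (∑ i ∈ F, σ i • φ i) i = if i ∈ F then σ i else 0 := by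
    intro i
    simp only [map_sum, map_smul, hφ, ContinuousLinearEquiv.apply_symm_apply, lp.coeFn_sum,
      Finset.sum_apply, lp.coeFn_smul, Pi.smul_apply, lp.single_apply, Pi.single_apply,
      smul_eq_mul, mul_ite, mul_one, mul_zero, Finset.sum_ite_eq]
  refine ⟨h1, (hT _).trans (lp.norm_le_of_forall_le zero_le_one fun i => ?_)⟩
  rw [h1]
  split_ifs with h
  · rcases hσ i h with h | h <;> simp [h]
  · simp

/-- In the setting of the lower-bound proof for `d_BM(L∞[0,1], ℓ∞)`:
for every measure-positive `A ⊆ B` the function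
`f_A = (1/(1+ε))·(φ + (1−r+6ε)·χ_A − θ·Φ_A)` (with `a = ‖Tχ_A‖`, `θ = (1−r)/(2ar+1)`,
and `Φ_A = ∑_{n∉I} (Tχ_A)(n)·φ_n`) satisfies `‖f_A‖ > 1`; moreover there exists such an
`A` with `|(Tf_A)(i)| < 1` for every `i ∈ I`. -/
theorem fA_norm_gt_one_and_exists_good_A
    (T : Lp ℝ ∞ μ01 ≃L[ℝ] lp (fun _ : ℕ => ℝ) ∞)
    (hT : ∀ g : Lp ℝ ∞ μ01, ‖g‖ ≤ ‖T g‖)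
    (φ : ℕ → Lp ℝ ∞ μ01) (hφ : ∀ n, φ n = T.symm (lp.single ∞ n 1))
    (r : ℝ)
    (hr : r = sSup {x : ℝ | ∃ (I : Finset ℕ) (σ : ℕ → ℝ),
      (∀ i ∈ I, σ i = 1 ∨ σ i = -1) ∧ x = ‖∑ i ∈ I, σ i • φ i‖})
    (hr6 : 1 / 6 ≤ r)
    (ε : ℝ) (hε : 0 < ε)
    (I : Finset ℕ) (σ : ℕ → ℝ) (hσ : ∀ i ∈ I, σ i = 1 ∨ σ i = -1)
    (φS : Lp ℝ ∞ μ01) (hφS : φS = ∑ i ∈ I, σ i • φ i)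
    (hφSnorm : r - ε < ‖φS‖)
    (B : Set ℝ) (hB : MeasurableSet B) (hBsub : B ⊆ Set.Icc (0 : ℝ) 1)
    (hBpos : 0 < μ01 B)
    (hφSB : ∀ᵐ x ∂μ01, x ∈ B → r - ε < (φS : ℝ → ℝ) x) :
    (∀ (A : Set ℝ), MeasurableSet A → A ⊆ B → 0 < μ01 A →
      ∀ χA ΦA fA : Lp ℝ ∞ μ01,
        (χA : ℝ → ℝ) =ᵐ[μ01] A.indicator (fun _ => (1 : ℝ)) →
        (∀ᵐ x ∂μ01, HasSum
          (fun n : {n : ℕ // n ∉ I} => (T χA) (n : ℕ) * (φ (n : ℕ) : ℝ → ℝ) x)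
          ((ΦA : ℝ → ℝ) x)) →
        fA = (1 / (1 + ε)) •
          (φS + (1 - r + 6 * ε) • χA - ((1 - r) / (2 * ‖T χA‖ * r + 1)) • ΦA) →
        1 < ‖fA‖) ∧
    (∃ (A : Set ℝ), MeasurableSet A ∧ A ⊆ B ∧ 0 < μ01 A ∧
      ∃ χA ΦA fA : Lp ℝ ∞ μ01,
        (χA : ℝ → ℝ) =ᵐ[μ01] A.indicator (fun _ => (1 : ℝ)) ∧
        (∀ᵐ x ∂μ01, HasSum
          (fun n : {n : ℕ // n ∉ I} => (T χA) (n : ℕ) * (φ (n : ℕ) : ℝ → ℝ) x)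
          ((ΦA : ℝ → ℝ) x)) ∧
        fA = (1 / (1 + ε)) •
          (φS + (1 - r + 6 * ε) • χA - ((1 - r) / (2 * ‖T χA‖ * r + 1)) • ΦA) ∧
        ∀ i ∈ I, |(T fA) i| < 1) := by
  have hbd : ∀ (F : Finset ℕ) (σ : ℕ → ℝ), (∀ i ∈ F, σ i = 1 ∨ σ i = -1) →
      ‖∑ i ∈ F, σ i • φ i‖ ≤ r := by
    intro F s hs
    rw [hr]
    refine le_csSup ⟨1, ?_⟩ ⟨F, s, hs, rfl⟩
    rintro x ⟨G, t, ht, rfl⟩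
    exact (norm_signed_le_one T hT φ hφ G t ht).2
  have hr1 : r ≤ 1 := by
    rw [hr]
    refine csSup_le ⟨_, I, σ, hσ, rfl⟩ ?_
    rintro x ⟨G, t, ht, rfl⟩
    exact (norm_signed_le_one T hT φ hφ G t ht).2
  have hr0 : 0 ≤ r := by linarith
  have hae := ae_sum_abs_le φ r hbd
  constructor
  · intro A hA hAB hApos χA ΦA fA hχ hΦ hfA
    set a := ‖T χA‖ with ha
    have ha0 : 0 ≤ a := norm_nonneg _
    have hden : 0 < 2 * a * r + 1 := by positivity
    set θ := (1 - r) / (2 * a * r + 1) with hθ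
    have hθ0 : 0 ≤ θ := div_nonneg (by linarith) hden.le
    have hθa : θ * a ≤ 3 := by
      rw [hθ, div_mul_eq_mul_div, div_le_iff₀ hden]
      nlinarith [mul_nonneg ha0 (sub_nonneg.2 hr6)]
    have hlow : ∀ᵐ x ∂μ01, x ∈ A → (1 + 2 * ε) / (1 + ε) ≤ (fA : ℝ → ℝ) x := by
      filter_upwards [hae, hφSB, hχ, hΦ, coeFn_sum_smul I σ φ,
        Lp.coeFn_smul (1 / (1 + ε)) (φS + (1 - r + 6 * ε) • χA - θ • ΦA),
        Lp.coeFn_sub (φS + (1 - r + 6 * ε) • χA) (θ • ΦA),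
        Lp.coeFn_add φS ((1 - r + 6 * ε) • χA),
        Lp.coeFn_smul (1 - r + 6 * ε) χA, Lp.coeFn_smul θ ΦA]
        with x h1 h2 h3 h4 h5 h6 h7 h8 h9 h10 hx
      have hφx := h2 (hAB hx)
      have hsumI : r - ε < ∑ i ∈ I, |(φ i : ℝ → ℝ) x| := by
        refine hφx.trans_le ?_
        rw [hφS, h5]
        refine Finset.sum_le_sum fun i hi => ?_
        refine (le_abs_self _).trans ?_
        rcases hσ i hi with h | h <;> simp [h]
      have hΦx : |(ΦA : ℝ → ℝ) x| ≤ a * ε := by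
        refine abs_hasSum_le I (T χA) (fun n => (φ n : ℝ → ℝ) x) ε ?_ _ h4
        intro F hF
        have := h1 (F ∪ I)
        rw [Finset.sum_union hF] at this
        linarith
      have hχx : (χA : ℝ → ℝ) x = 1 := by rw [h3]; simp [hx]
      rw [hfA, h6, Pi.smul_apply, h7, Pi.sub_apply, h8, Pi.add_apply, h9, h10,
        Pi.smul_apply, Pi.smul_apply, hχx]
      simp only [smul_eq_mul, mul_one]
      rw [one_div, inv_mul_eq_div]
      gcongr
      have : θ * (ΦA : ℝ → ℝ) x ≤ 3 * ε := by
        calc θ * (ΦA : ℝ → ℝ) x ≤ θ * (a * ε) := by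
              gcongr; exact (le_abs_self _).trans hΦx
          _ = (θ * a) * ε := by ring
          _ ≤ 3 * ε := by gcongr
      linarith
    have hex : ∃ x ∈ A, (x ∈ A → (1 + 2 * ε) / (1 + ε) ≤ (fA : ℝ → ℝ) x) ∧
        |(fA : ℝ → ℝ) x| ≤ ‖fA‖ := by
      have := (hlow.and (ae_abs_le_norm fA))
      by_contra hcon
      push Not at hcon
      refine hApos.ne' (measure_mono_null ?_ (ae_iff.1 this))
      intro x hx hx'
      exact absurd hx'.2 (not_le.2 (hcon x hx hx'.1))
    obtain ⟨x, hx, h1, h2⟩ := hex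
    have h3 : 1 < (1 + 2 * ε) / (1 + ε) := by
      rw [lt_div_iff₀ (by linarith)]; linarith
    exact h3.trans_le ((h1 hx).trans ((le_abs_self _).trans h2))
  · obtain ⟨S, hS⟩ := exists_synthesis φ r hr0 hae I
    obtain ⟨A, hA, hdis⟩ := exists_disjoint_seq B hB hBpos
    let χ : ℕ → Lp ℝ ∞ μ01 := fun k =>
      indicatorConstLp ∞ (hA k).1 (measure_ne_top μ01 (A k)) (1 : ℝ)
    have hχ : ∀ k, (χ k : ℝ → ℝ) =ᵐ[μ01] (A k).indicator (fun _ => (1 : ℝ)) :=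
      fun k => indicatorConstLp_coeFn
    let E : ℕ → lp (fun _ : ℕ => ℝ) ∞ →L[ℝ] ℝ := fun i =>
      LinearMap.mkContinuous
        { toFun := fun y => y i, map_add' := fun _ _ => rfl, map_smul' := fun _ _ => rfl } 1
        (fun y => by
          rw [one_mul]; exact lp.norm_apply_le_norm (by simp) y i)
    have hE : ∀ i y, E i y = y i := fun _ _ => rfl
    let TL : Lp ℝ ∞ μ01 →L[ℝ] lp (fun _ : ℕ => ℝ) ∞ := T
    let L1 : ℕ → Lp ℝ ∞ μ01 →L[ℝ] ℝ := fun i => (E i).comp TL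
    let L2 : ℕ → Lp ℝ ∞ μ01 →L[ℝ] ℝ := fun i => (E i).comp (TL.comp (S.comp TL))
    have hδ : 0 < ε / (3 + 6 * ε) := by positivity
    have hev : ∀ᶠ k in Filter.atTop, ∀ i ∈ I,
        |L1 i (χ k)| < ε / (3 + 6 * ε) ∧ |L2 i (χ k)| < ε / (3 + 6 * ε) := by
      rw [Filter.eventually_all_finset]
      intro i _
      exact ((functional_tendsto A hdis χ hχ (L1 i)).eventually_lt_const hδ).and
        ((functional_tendsto A hdis χ hχ (L2 i)).eventually_lt_const hδ)
    obtain ⟨k, hk⟩ := hev.exists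
    refine ⟨A k, (hA k).1, (hA k).2.1, (hA k).2.2, χ k, S (T (χ k)), _, hχ k,
      hS (T (χ k)), rfl, ?_⟩
    intro i hi
    obtain ⟨h1, h2⟩ := hk i hi
    change |T (χ k) i| < _ at h1
    change |T (S (T (χ k))) i| < _ at h2
    set δ := ε / (3 + 6 * ε) with hδdef
    set θ := (1 - r) / (2 * ‖T (χ k)‖ * r + 1) with hθ
    have hden : 1 ≤ 2 * ‖T (χ k)‖ * r + 1 := by
      have : 0 ≤ 2 * ‖T (χ k)‖ * r := by positivity
      linarith
    have hθ0 : 0 ≤ θ := div_nonneg (by linarith) (by linarith)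
    have hθ1 : θ ≤ 1 := by
      rw [hθ, div_le_one (by linarith)]; linarith
    have hδe : δ * (3 + 6 * ε) = ε := div_mul_cancel₀ _ (by positivity)
    have hTφ : T φS i = σ i := by
      rw [hφS, (norm_signed_le_one T hT φ hφ I σ hσ).1 i, if_pos hi]
    have hσi : |σ i| = 1 := by rcases hσ i hi with h | h <;> simp [h]
    have hTf : T ((1 / (1 + ε)) • (φS + (1 - r + 6 * ε) • χ k - θ • S (T (χ k)))) i
        = (σ i + (1 - r + 6 * ε) * T (χ k) i - θ * T (S (T (χ k))) i) / (1 + ε) := by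
      rw [map_smul, map_sub, map_add, map_smul, map_smul]
      simp only [lp.coeFn_smul, lp.coeFn_sub, lp.coeFn_add, Pi.smul_apply, Pi.sub_apply,
        Pi.add_apply, smul_eq_mul, hTφ]
      ring
    rw [hTf, abs_div, abs_of_pos (by linarith : 0 < 1 + ε), div_lt_one (by linarith)]
    have hc0 : 0 ≤ 1 - r + 6 * ε := by linarith
    have b1 : |(1 - r + 6 * ε) * T (χ k) i| ≤ (1 + 6 * ε) * δ := by
      rw [abs_mul, abs_of_nonneg hc0]
      exact mul_le_mul (by linarith) h1.le (abs_nonneg _) (by linarith)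
    have b2 : |θ * T (S (T (χ k))) i| ≤ 1 * δ := by
      rw [abs_mul, abs_of_nonneg hθ0]
      exact mul_le_mul hθ1 h2.le (abs_nonneg _) (by linarith)
    have b3 := abs_sub (σ i + (1 - r + 6 * ε) * T (χ k) i) (θ * T (S (T (χ k))) i)
    have b4 := abs_add_le (σ i) ((1 - r + 6 * ε) * T (χ k) i)
    nlinarith
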